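/- Let E be a finite-dimensional real inner product space and Φ ⊆ E \ {0} a finite crystallographic root system (possibly non-reduced). If V ⊆ span_ℝ(Φ) is a 2-small subspace and α, β ∈ Φ are linearly independent roots such that (ℝα + ℝβ) ∩ V is one-dimensional, then there exists an irreducible saturated root subsystem Ψ ⊆ Φ of rank 2 with α ∈ Ψ such that β ∉ Ψ and (span_ℝ(Ψ) + ℝβ) ∩ V is still one-dimensional. -/

import Mathlib

open scoped RealInnerProductSpace

variable {E : Type*} [NormedAddCommGroup E] [InnerProductSpace ℝ E]

/-- The reflection of `x` in the hyperplane orthogonal to `α`. -/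
noncomputable def rootReflection (α x : E) : E :=
  x - (2 * ⟪x, α⟫ / ⟪α, α⟫) • α

/-- `Φ` is a (possibly non-reduced) crystallographic root system in `E`. -/
structure IsRootSystem (Φ : Set E) : Prop where
  finite : Φ.Finite
  ne_zero : ∀ α ∈ Φ, α ≠ 0
  crystallographic : ∀ α ∈ Φ, ∀ β ∈ Φ, ∃ n : ℤ, 2 * ⟪β, α⟫ / ⟪α, α⟫ = (n : ℝ)
  reflect_mem : ∀ α ∈ Φ, ∀ β ∈ Φ, rootReflection α β ∈ Φ

/-- Two roots of `Φ` are related if they both belong to `Φ` and are non-orthogonal. -/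
def chainRel (Φ : Set E) (a b : E) : Prop := a ∈ Φ ∧ b ∈ Φ ∧ ⟪a, b⟫ ≠ 0

/-- The irreducible component of `Φ` containing the root `α`: the set of roots connected to `α`
by a chain of pairwise non-orthogonal roots. -/
def component (Φ : Set E) (α : E) : Set E := {β | Relation.TransGen (chainRel Φ) α β}

/-- A subspace `V ≤ span ℝ Φ` is `k`-small if for every irreducible component `Ψ` of `Φ`
the codimension of `V ∩ span ℝ Ψ` in `span ℝ Ψ` is at least `k`. -/
def IsSmall (Φ : Set E) (V : Submodule ℝ E) (k : ℕ) : Prop :=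
  ∀ α ∈ Φ,
    Module.finrank ℝ ↥(V ⊓ Submodule.span ℝ (component Φ α)) + k ≤
      Module.finrank ℝ ↥(Submodule.span ℝ (component Φ α))

/-- A saturated root subsystem of `Φ`: the intersection of `Φ` with a linear subspace. -/
def IsSaturatedSubsystem (Φ Ψ : Set E) : Prop :=
  ∃ U : Submodule ℝ E, Ψ = Φ ∩ ↑U

/-- A set of roots is irreducible if it is nonempty and any two of its roots are joined by a
chain of pairwise non-orthogonal roots inside it. -/
def IsIrreducibleSubsystem (Ψ : Set E) : Prop :=
  Ψ.Nonempty ∧ ∀ a ∈ Ψ, ∀ b ∈ Ψ, Relation.TransGen (chainRel Ψ) a b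

/-- The rank of a set of roots: the dimension of its real span. -/
noncomputable def rootRank (Ψ : Set E) : ℕ :=
  Module.finrank ℝ ↥(Submodule.span ℝ Ψ)

theorem exists_mem_inner_ne_zero_of_mem_component {Φ : Set E} (hΦ : IsRootSystem Φ) {α δ : E}
    (h : δ ∈ component Φ α) : δ ∈ Φ ∧ ∃ γ ∈ Φ, ⟪γ, α⟫ ≠ 0 ∧ ⟪γ, δ⟫ ≠ 0 := by
  have h' : Relation.TransGen (chainRel Φ) α δ := h
  clear h
  induction h' with
  | single hb =>
    obtain ⟨-, hb, hab⟩ := hb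
    exact ⟨hb, _, hb, by rwa [real_inner_comm], inner_self_ne_zero.2 (hΦ.ne_zero _ hb)⟩
  | @tail b c _ hbc ih =>
    obtain ⟨hb, hc, hbc⟩ := hbc
    obtain ⟨-, γ, hγ, hγα, hγb⟩ := ih
    refine ⟨hc, ?_⟩
    by_cases hγc : ⟪γ, c⟫ = 0
    · by_cases hbα : ⟪b, α⟫ = 0
      · refine ⟨rootReflection b γ, hΦ.reflect_mem b hb γ hγ, ?_, ?_⟩
        · simpa [rootReflection, inner_sub_left, inner_smul_left, hbα] using hγα
        · simpa [rootReflection, inner_sub_left, inner_smul_left, hγc, hbc, hγb] using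
            hΦ.ne_zero b hb
      · exact ⟨b, hb, hbα, hbc⟩
    · exact ⟨γ, hγ, hγα, hγc⟩

/-- The roots that are not orthogonal to `α` span the irreducible component of `α`. -/
theorem component_subset_span_inner_ne_zero {Φ : Set E} (hΦ : IsRootSystem Φ) (α : E) :
    component Φ α ⊆ Submodule.span ℝ {γ ∈ Φ | ⟪γ, α⟫ ≠ 0} := by
  intro δ hδ
  obtain ⟨hδΦ, γ, hγ, hγα, hγδ⟩ := exists_mem_inner_ne_zero_of_mem_component hΦ hδ
  by_cases hδα : ⟪δ, α⟫ = 0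
  · have hγ' := hΦ.reflect_mem δ hδΦ γ hγ
    have hγ'α : ⟪rootReflection δ γ, α⟫ ≠ 0 := by
      simpa [rootReflection, inner_sub_left, inner_smul_left, hδα] using hγα
    have hc : 2 * ⟪γ, δ⟫ / ⟪δ, δ⟫ ≠ 0 := by
      simpa [hγδ] using hΦ.ne_zero δ hδΦ
    refine (Submodule.smul_mem_iff _ hc).1 ?_
    have := Submodule.sub_mem _
      (Submodule.subset_span (R := ℝ) (s := {γ ∈ Φ | ⟪γ, α⟫ ≠ 0}) ⟨hγ, hγα⟩)
      (Submodule.subset_span ⟨hγ', hγ'α⟩)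
    simpa [rootReflection] using this
  · exact Submodule.subset_span ⟨hδΦ, hδα⟩

/-- Two non-orthogonal roots lie in an irreducible saturated subsystem with the same span. -/
theorem isIrreducibleSubsystem_inter_span_pair {Φ : Set E} (hΦ : ∀ a ∈ Φ, a ≠ 0) {α γ : E}
    (hα : α ∈ Φ) (hγ : γ ∈ Φ) (hγα : ⟪γ, α⟫ ≠ 0) :
    IsIrreducibleSubsystem (Φ ∩ (Submodule.span ℝ {α, γ} : Submodule ℝ E)) := by
  set Ψ : Set E := Φ ∩ (Submodule.span ℝ {α, γ} : Submodule ℝ E) with hΨ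
  have hαΨ : α ∈ Ψ := ⟨hα, Submodule.subset_span (by simp)⟩
  have hγΨ : γ ∈ Ψ := ⟨hγ, Submodule.subset_span (by simp)⟩
  have hsymm : ∀ {a b}, chainRel Ψ a b → chainRel Ψ b a := fun h =>
    ⟨h.2.1, h.1, by rw [real_inner_comm]; exact h.2.2⟩
  have hγα' : chainRel Ψ γ α := ⟨hγΨ, hαΨ, hγα⟩
  have key : ∀ δ ∈ Ψ, chainRel Ψ δ α ∨ chainRel Ψ δ γ := by
    intro δ hδ
    by_contra! h
    have h1 : ⟪δ, α⟫ = 0 := by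
      by_contra h'
      exact h.1 ⟨hδ, hαΨ, h'⟩
    have h2 : ⟪δ, γ⟫ = 0 := by
      by_contra h'
      exact h.2 ⟨hδ, hγΨ, h'⟩
    obtain ⟨a, b, hab⟩ := Submodule.mem_span_pair.1 hδ.2
    apply inner_self_ne_zero (𝕜 := ℝ).2 (hΦ δ hδ.1)
    nth_rewrite 2 [← hab]
    simp [inner_add_right, inner_smul_right, h1, h2]
  have to_α : ∀ δ ∈ Ψ, Relation.TransGen (chainRel Ψ) δ α := by
    intro δ hδ
    rcases key δ hδ with h | h
    · exact .single h
    · exact .tail (.single h) hγα'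
  have from_α : ∀ δ ∈ Ψ, Relation.TransGen (chainRel Ψ) α δ := by
    intro δ hδ
    rcases key δ hδ with h | h
    · exact .single (hsymm h)
    · exact .tail (.single (hsymm hγα')) (hsymm h)
  exact ⟨⟨α, hαΨ⟩, fun a ha b hb => (to_α a ha).trans (from_α b hb)⟩

/-- If `L ⊓ V` has codimension at most one in `L` and `W ≤ V ⊔ L`, then `V ⊓ W` has codimension
at most one in `W`. -/
theorem finrank_le_finrank_inf_add_one [FiniteDimensional ℝ E] {V L W : Submodule ℝ E}
    (hL : Module.finrank ℝ L ≤ Module.finrank ℝ ↥(L ⊓ V) + 1) (hW : W ≤ L ⊔ V) :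
    Module.finrank ℝ W ≤ Module.finrank ℝ ↥(V ⊓ W) + 1 := by
  have h1 := Submodule.finrank_sup_add_finrank_inf_eq L V
  have h2 := Submodule.finrank_sup_add_finrank_inf_eq V W
  have h3 : Module.finrank ℝ ↥(V ⊔ W) ≤ Module.finrank ℝ ↥(L ⊔ V) :=
    Submodule.finrank_mono (sup_le le_sup_right hW)
  lia

/-- Adding a vector outside `L ⊔ V` to `L` does not change the intersection with `V`. -/
theorem sup_span_singleton_inf_eq {L V : Submodule ℝ E} {γ : E} (hγ : γ ∉ L ⊔ V) :
    (L ⊔ Submodule.span ℝ {γ}) ⊓ V = L ⊓ V := by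
  refine le_antisymm ?_ (inf_le_inf_right _ le_sup_left)
  rintro x ⟨hx, hxV⟩
  obtain ⟨l, hl, y, hy, rfl⟩ := Submodule.mem_sup.1 hx
  obtain ⟨c, rfl⟩ := Submodule.mem_span_singleton.1 hy
  rcases eq_or_ne c 0 with rfl | hc
  · exact ⟨by simpa using hl, by simpa using hxV⟩
  · refine absurd ((Submodule.smul_mem_iff _ hc).1 ?_) hγ
    have := Submodule.sub_mem _ (Submodule.mem_sup_right (S := L) hxV)
      (Submodule.mem_sup_left hl)
    simpa using this

/-- If `V` is a `2`-small subspace of `span ℝ Φ` and `α, β ∈ Φ` are linearly independent roots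
with `(ℝα + ℝβ) ∩ V` one-dimensional, then there is a rank-2 irreducible saturated root
subsystem `Ψ ⊆ Φ` with `α ∈ Ψ`, `β ∉ Ψ`, and `(span ℝ Ψ + ℝβ) ∩ V` still one-dimensional. -/
theorem exists_rank_two_subsystem_of_inf_one_dim [FiniteDimensional ℝ E]
    (Φ : Set E) (hΦ : IsRootSystem Φ)
    (V : Submodule ℝ E) (hV : V ≤ Submodule.span ℝ Φ) (hsmall : IsSmall Φ V 2)
    (α β : E) (hα : α ∈ Φ) (hβ : β ∈ Φ) (hind : LinearIndependent ℝ ![α, β])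
    (hdim : Module.finrank ℝ
      ↥((Submodule.span ℝ {α} ⊔ Submodule.span ℝ {β}) ⊓ V) = 1) :
    ∃ Ψ : Set E, IsSaturatedSubsystem Φ Ψ ∧ IsIrreducibleSubsystem Ψ ∧ rootRank Ψ = 2 ∧
      α ∈ Ψ ∧ β ∉ Ψ ∧
      Module.finrank ℝ
        ↥((Submodule.span ℝ Ψ ⊔ Submodule.span ℝ {β}) ⊓ V) = 1 := by
  set L : Submodule ℝ E := Submodule.span ℝ {α} ⊔ Submodule.span ℝ {β} with hL
  have hLpair : L = Submodule.span ℝ {α, β} := by rw [hL, ← Submodule.span_union]; rfl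
  have hLrank : Module.finrank ℝ L = 2 := by
    have := finrank_span_eq_card hind
    rwa [Matrix.range_cons_cons_empty, ← hLpair, Fintype.card_fin] at this
  obtain ⟨γ, hγ, hγα, hγL⟩ : ∃ γ ∈ Φ, ⟪γ, α⟫ ≠ 0 ∧ γ ∉ L ⊔ V := by
    by_contra! h
    have hW : Submodule.span ℝ (component Φ α) ≤ L ⊔ V := by
      refine Submodule.span_le.2 ((component_subset_span_inner_ne_zero hΦ α).trans ?_)
      exact Submodule.span_le.2 fun γ hγ => h γ hγ.1 hγ.2
    have h1 := finrank_le_finrank_inf_add_one (by lia) hW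
    have h2 := hsmall α hα
    lia
  have hγL' : γ ∉ L := fun h => hγL (Submodule.mem_sup_left h)
  have hindep : LinearIndependent ℝ ![α, γ] := by
    refine (LinearIndependent.pair_iff' (hΦ.ne_zero α hα)).2 fun a ha => hγL' ?_
    rw [← ha]
    exact L.smul_mem _ (Submodule.mem_sup_left (Submodule.mem_span_singleton_self α))
  have hspan : Submodule.span ℝ (Φ ∩ (Submodule.span ℝ {α, γ} : Submodule ℝ E)) =
      Submodule.span ℝ {α, γ} := by
    refine le_antisymm (Submodule.span_le.2 Set.inter_subset_right) (Submodule.span_mono ?_)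
    rintro x (rfl | rfl)
    · exact ⟨hα, Submodule.subset_span (by simp)⟩
    · exact ⟨hγ, Submodule.subset_span (by simp)⟩
  refine ⟨Φ ∩ (Submodule.span ℝ {α, γ} : Submodule ℝ E), ⟨_, rfl⟩,
    isIrreducibleSubsystem_inter_span_pair hΦ.ne_zero hα hγ hγα, ?_,
    ⟨hα, Submodule.subset_span (by simp)⟩, ?_, ?_⟩
  · have := finrank_span_eq_card hindep
    rwa [Matrix.range_cons_cons_empty, ← hspan, Fintype.card_fin] at this
  · rintro ⟨-, h⟩
    obtain ⟨a, b, hab⟩ := Submodule.mem_span_pair.1 h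
    rcases eq_or_ne b 0 with rfl | hb
    · exact (LinearIndependent.pair_iff' (hΦ.ne_zero α hα)).1 hind a (by simpa using hab)
    · refine hγL' ((Submodule.smul_mem_iff _ hb).1 ?_)
      rw [← eq_sub_iff_add_eq'] at hab
      rw [hab]
      exact Submodule.sub_mem _ (Submodule.mem_sup_right (Submodule.mem_span_singleton_self β))
        (L.smul_mem _ (Submodule.mem_sup_left (Submodule.mem_span_singleton_self α)))
  · rw [hspan, Submodule.span_insert, sup_right_comm, sup_span_singleton_inf_eq hγL, hdim]
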